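/- There exists an NPA over the two-letter alphabet {a,b} whose min-semantics language L^min is not recognized by any weighted finite automaton: for no n ∈ ℕ, vector α ∈ ℝⁿ, matrices M_a, M_b ∈ ℝ^{n×n}, and vector η ∈ ℝⁿ does L^min(c₁⋯c_k) = αᵀ M_{c₁} ⋯ M_{c_k} η hold for all words. In particular, NPAs are strictly more expressive than deterministic probabilistic automata. -/

import Mathlib

open Matrix

/-- The two-letter alphabet `{a, b}`. -/
inductive AB : Type
  | a : AB
  | b : AB
deriving DecidableEq

/-- The Dirac distribution at a state. -/
def dirac {S : Type*} [DecidableEq S] (s0 : S) : S → ℝ :=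
  fun s => if s = s0 then 1 else 0

/-- A nondeterministic probabilistic automaton (data part). -/
structure NPA (A S : Type*) where
  init : S
  out : S → ℝ
  tr : A → S → Set (S → ℝ)

/-- `d` is a probability distribution on the finite set `S`. -/
def IsDist {S : Type*} [Fintype S] (d : S → ℝ) : Prop :=
  (∀ s, 0 ≤ d s) ∧ ∑ s, d s = 1

/-- `M` is a well-formed NPA: outputs lie in `[0,1]`, transition sets consist of
probability distributions, and each transition set is the convex hull of a nonempty
finite set of distributions. -/
def NPA.Valid {A S : Type*} [Fintype S] (M : NPA A S) : Prop :=
  (∀ s, M.out s ∈ Set.Icc (0 : ℝ) 1) ∧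
  (∀ a s, ∀ d ∈ M.tr a s, IsDist d) ∧
  (∀ a s, ∃ G : Finset (S → ℝ), G.Nonempty ∧ M.tr a s = convexHull ℝ (G : Set (S → ℝ)))

/-- One step of the determinized automaton on a set of distributions. -/
def NPA.step {A S : Type*} [Fintype S] (M : NPA A S) (a : A) (X : Set (S → ℝ)) :
    Set (S → ℝ) :=
  { d' | ∃ d ∈ X, ∃ f : S → S → ℝ, (∀ s, f s ∈ M.tr a s) ∧
      d' = fun s' => ∑ s, d s * f s s' }

/-- The set of distributions reached after reading the word `u`. -/
def NPA.reach {A S : Type*} [Fintype S] [DecidableEq S] (M : NPA A S) (u : List A) :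
    Set (S → ℝ) :=
  u.foldl (fun X a => M.step a X) {dirac M.init}

/-- The min-semantics language of an NPA. -/
noncomputable def NPA.Lmin {A S : Type*} [Fintype S] [DecidableEq S]
    (M : NPA A S) (u : List A) : ℝ :=
  sInf ((fun d => ∑ s, d s * M.out s) '' M.reach u)

/-- One extreme point of the transition set of `maxAutomaton`: from state `0` move to state `1`;
state `1` survives `a` with probability `1/2`, state `2` survives `b` with probability `1/2`. -/
noncomputable def extremeLeft : AB → Fin 4 → Fin 4 → ℝ
  | .a => ![![0, 1, 0, 0], ![0, 1 / 2, 0, 1 / 2], ![0, 0, 1, 0], ![0, 0, 0, 1]]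
  | .b => ![![0, 1, 0, 0], ![0, 1, 0, 0], ![0, 0, 1 / 2, 1 / 2], ![0, 0, 0, 1]]

/-- The other extreme point: it differs from `extremeLeft` only in moving from `0` to `2`. -/
noncomputable def extremeRight : AB → Fin 4 → Fin 4 → ℝ
  | .a => ![![0, 0, 1, 0], ![0, 1 / 2, 0, 1 / 2], ![0, 0, 1, 0], ![0, 0, 0, 1]]
  | .b => ![![0, 0, 1, 0], ![0, 1, 0, 0], ![0, 0, 1 / 2, 1 / 2], ![0, 0, 0, 1]]

/-- An automaton with `Lmin (c :: w) = 2 ^ (-max |w|_a |w|_b)`. -/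
noncomputable def maxAutomaton : NPA AB (Fin 4) where
  init := 0
  out := ![1, 1, 1, 0]
  tr c s := segment ℝ (extremeLeft c s) (extremeRight c s)

theorem convex_setOf_isDist {S : Type*} [Fintype S] : Convex ℝ {d : S → ℝ | IsDist d} :=
  convex_stdSimplex ℝ S

theorem maxAutomaton_valid : maxAutomaton.Valid := by
  refine ⟨?_, ?_, ?_⟩
  · intro s
    fin_cases s <;> simp [maxAutomaton]
  · intro c s d hd
    refine convex_setOf_isDist.segment_subset ?_ ?_ hd
    · refine ⟨fun i => ?_, ?_⟩
      · cases c <;> fin_cases s <;> fin_cases i <;> norm_num [extremeLeft]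
      · cases c <;> fin_cases s <;> simp [extremeLeft, Fin.sum_univ_four] <;> norm_num
    · refine ⟨fun i => ?_, ?_⟩
      · cases c <;> fin_cases s <;> fin_cases i <;> norm_num [extremeRight]
      · cases c <;> fin_cases s <;> simp [extremeRight, Fin.sum_univ_four] <;> norm_num
  · intro c s
    classical
    refine ⟨{extremeLeft c s, extremeRight c s}, by simp, ?_⟩
    simp [maxAutomaton, convexHull_pair]

/-- The distributions with mass `t * x` at `1`, mass `(1 - t) * y` at `2` and the remaining mass
at the sink `3`, for `t ∈ [0, 1]`. -/
def splitDists (x y : ℝ) : Set (Fin 4 → ℝ) :=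
  {d | ∃ t ∈ Set.Icc (0 : ℝ) 1, d = ![0, t * x, (1 - t) * y, 1 - t * x - (1 - t) * y]}

theorem maxAutomaton_step_init (c : AB) :
    maxAutomaton.step c {dirac maxAutomaton.init} = splitDists 1 1 := by
  ext d'
  constructor
  · rintro ⟨d, rfl, f, hf, rfl⟩
    obtain ⟨t, u, ht, hu, htu, h⟩ := hf 0
    refine ⟨t, ⟨ht, by linarith⟩, ?_⟩
    obtain rfl : u = 1 - t := by linarith
    ext i
    cases c <;> fin_cases i <;>
      simp [maxAutomaton, dirac, ← h, extremeLeft, extremeRight]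
  · rintro ⟨t, ⟨ht, ht'⟩, rfl⟩
    refine ⟨_, rfl, fun s => t • extremeLeft c s + (1 - t) • extremeRight c s,
      fun s => ⟨t, 1 - t, ht, by linarith, by ring, rfl⟩, ?_⟩
    ext i
    cases c <;> fin_cases i <;>
      simp [maxAutomaton, dirac, extremeLeft, extremeRight]

theorem maxAutomaton_eq_of_mem_tr {c : AB} {s : Fin 4} (hs : s ≠ 0) {d : Fin 4 → ℝ}
    (hd : d ∈ maxAutomaton.tr c s) : d = extremeLeft c s := by
  have h : extremeRight c s = extremeLeft c s := by
    cases c <;> fin_cases s <;> simp_all [extremeLeft, extremeRight]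
  simpa [maxAutomaton, h] using hd

theorem maxAutomaton_step_splitDists {c : AB} {x y x' y' : ℝ}
    (h : ∀ t : ℝ, (fun s' => ∑ s, (![0, t * x, (1 - t) * y, 1 - t * x - (1 - t) * y] :
        Fin 4 → ℝ) s * extremeLeft c s s') =
      ![0, t * x', (1 - t) * y', 1 - t * x' - (1 - t) * y']) :
    maxAutomaton.step c (splitDists x y) = splitDists x' y' := by
  ext d'
  constructor
  · rintro ⟨_, ⟨t, ht, rfl⟩, f, hf, rfl⟩
    refine ⟨t, ht, ?_⟩
    rw [← h]
    ext s'
    refine Finset.sum_congr rfl fun s _ => ?_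
    by_cases hs : s = 0
    · simp [hs]
    · rw [maxAutomaton_eq_of_mem_tr hs (hf s)]
  · rintro ⟨t, ht, rfl⟩
    exact ⟨_, ⟨t, ht, rfl⟩, extremeLeft c, fun s => left_mem_segment ℝ _ _, (h t).symm⟩

theorem maxAutomaton_step_a (x y : ℝ) :
    maxAutomaton.step .a (splitDists x y) = splitDists (x / 2) y := by
  refine maxAutomaton_step_splitDists fun t => ?_
  ext i
  fin_cases i <;> simp [extremeLeft, Fin.sum_univ_four] <;> ring

theorem maxAutomaton_step_b (x y : ℝ) :
    maxAutomaton.step .b (splitDists x y) = splitDists x (y / 2) := by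
  refine maxAutomaton_step_splitDists fun t => ?_
  ext i
  fin_cases i <;> simp [extremeLeft, Fin.sum_univ_four] <;> ring

theorem maxAutomaton_foldl_a (i : ℕ) (x y : ℝ) :
    (List.replicate i AB.a).foldl (fun X c => maxAutomaton.step c X) (splitDists x y) =
      splitDists (x / 2 ^ i) y := by
  induction i generalizing x with
  | zero => simp
  | succ i ih => rw [List.replicate_succ, List.foldl_cons, maxAutomaton_step_a, ih, pow_succ',
      div_div]

theorem maxAutomaton_foldl_b (j : ℕ) (x y : ℝ) :
    (List.replicate j AB.b).foldl (fun X c => maxAutomaton.step c X) (splitDists x y) =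
      splitDists x (y / 2 ^ j) := by
  induction j generalizing y with
  | zero => simp
  | succ j ih => rw [List.replicate_succ, List.foldl_cons, maxAutomaton_step_b, ih, pow_succ',
      div_div]

theorem sInf_value_splitDists (x y : ℝ) :
    sInf ((fun d => ∑ s, d s * maxAutomaton.out s) '' splitDists x y) = min x y := by
  have hval (t : ℝ) : ∑ s, (![0, t * x, (1 - t) * y, 1 - t * x - (1 - t) * y] :
      Fin 4 → ℝ) s * maxAutomaton.out s = t * x + (1 - t) * y := by
    simp [maxAutomaton, Fin.sum_univ_four]
  refine IsLeast.csInf_eq ⟨?_, ?_⟩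
  · rcases le_total x y with h | h
    · exact ⟨_, ⟨1, by simp, rfl⟩, by simp only [hval]; simp [h]⟩
    · exact ⟨_, ⟨0, by simp, rfl⟩, by simp only [hval]; simp [h]⟩
  · rintro _ ⟨_, ⟨t, ⟨ht, ht'⟩, rfl⟩, rfl⟩
    simp only [hval]
    nlinarith [mul_le_mul_of_nonneg_left (min_le_left x y) ht,
      mul_le_mul_of_nonneg_left (min_le_right x y) (sub_nonneg.2 ht')]

theorem maxAutomaton_Lmin (i j : ℕ) :
    maxAutomaton.Lmin (List.replicate (i + 1) AB.a ++ List.replicate j AB.b) =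
      1 / 2 ^ max i j := by
  rw [NPA.Lmin, NPA.reach, List.replicate_succ, List.cons_append, List.foldl_cons,
    maxAutomaton_step_init, List.foldl_append, maxAutomaton_foldl_a, maxAutomaton_foldl_b,
    sInf_value_splitDists]
  rcases le_total i j with h | h
  · rw [max_eq_right h, min_eq_right]
    gcongr
    norm_num
  · rw [max_eq_left h, min_eq_left]
    gcongr
    norm_num

/-- The infinite matrix with entries `2 ^ (-max i j)` has infinite rank. -/
theorem not_exists_dotProduct_eq_max (n : ℕ) (v w : ℕ → Fin n → ℝ) :
    ¬ ∀ i j, v i ⬝ᵥ w j = 1 / 2 ^ max i j := by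
  intro h
  have hdual (i j : ℕ) : (v i - v (i + 1)) ⬝ᵥ (w j - w (j + 1)) =
      if i = j then 1 / 2 ^ (j + 1) else 0 := by
    simp only [sub_dotProduct, dotProduct_sub, h]
    rcases lt_trichotomy i j with hij | rfl | hij
    · rw [if_neg hij.ne, max_eq_right hij.le, max_eq_right (by lia : i ≤ j + 1),
        max_eq_right (by lia : i + 1 ≤ j), max_eq_right (by lia : i + 1 ≤ j + 1)]
      ring
    · rw [if_pos rfl, max_self, max_self, max_eq_right i.le_succ, max_eq_left i.le_succ,
        Nat.succ_eq_add_one]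
      field_simp
      ring
    · rw [if_neg hij.ne', max_eq_left hij.le, max_eq_left (by lia : j + 1 ≤ i),
        max_eq_left (by lia : j ≤ i + 1), max_eq_left (by lia : j + 1 ≤ i + 1)]
      ring
  have hli : LinearIndependent ℝ fun i => v i - v (i + 1) := by
    rw [linearIndependent_iff']
    intro s g hg j hj
    have := congrArg (· ⬝ᵥ (w j - w (j + 1))) hg
    simpa only [sum_dotProduct, smul_dotProduct, hdual, smul_eq_mul, mul_ite, mul_zero,
      Finset.sum_ite_eq', hj, if_true, zero_dotProduct, mul_eq_zero, one_div, inv_eq_zero,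
      pow_eq_zero_iff j.succ_ne_zero, OfNat.ofNat_ne_zero, or_false] using this
  exact not_finite_iff_infinite.2 inferInstance hli.finite

/-- There exists an NPA over `{a, b}` whose min-semantics language is not recognized by
any weighted finite automaton. -/
theorem stmt7 :
    ∃ (m : ℕ) (M : NPA AB (Fin m)), M.Valid ∧
      ¬ ∃ (n : ℕ) (α η : Fin n → ℝ) (Mat : AB → Matrix (Fin n) (Fin n) ℝ),
        ∀ u : List AB, M.Lmin u = α ⬝ᵥ ((u.map Mat).prod).mulVec η := by
  refine ⟨4, maxAutomaton, maxAutomaton_valid, ?_⟩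
  rintro ⟨n, α, η, Mat, h⟩
  refine not_exists_dotProduct_eq_max n (fun i => α ᵥ* Mat .a ^ (i + 1))
    (fun j => Mat .b ^ j *ᵥ η) fun i j => ?_
  rw [← maxAutomaton_Lmin, h, List.map_append, List.map_replicate, List.map_replicate,
    List.prod_append, List.prod_replicate, List.prod_replicate, ← mulVec_mulVec,
    dotProduct_mulVec _ (Mat .a ^ (i + 1))]
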